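/- Let p ≥ 0 be an integer, n* > 0 with n* ≠ 1, ε > 0, and let κ : (n*−ε, n*+ε) → ℂ be a continuous ITE trajectory (F_p(κ(n), n) = 0 for all n) that is differentiable at every n ≠ n*. Suppose κ(n*) = κ* > 0 with J_p(κ*) = 0 and J_p'(κ*) ≠ 0, and that J_p(κ(n)) ≠ 0 and J_p(√n·κ(n)) ≠ 0 for every n ≠ n*. Then the cubed displacement is differentiable at n* with lim_{n→n*} (κ(n) − κ*)³/(n − n*) = −3κ*/(2·n*·(n* − 1)). -/

import Mathlib

open Complex Real Filter Set

/-- Bessel function of the first kind of integer order `p`. -/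
noncomputable def besselJ (p : ℕ) (z : ℂ) : ℂ :=
  ∑' m : ℕ, ((-1 : ℂ) ^ m / ((Nat.factorial m : ℂ) * (Nat.factorial (m + p) : ℂ)))
    * (z / 2) ^ (2 * m + p)

/-- Derivative of the Bessel function. -/
noncomputable def besselJ' (p : ℕ) (z : ℂ) : ℂ := deriv (besselJ p) z

/-- The ITE determinant function `F_p(κ, n)`. -/
noncomputable def Fp (p : ℕ) (κ : ℂ) (n : ℝ) : ℂ :=
  κ * (besselJ' p κ * besselJ p ((Real.sqrt n : ℂ) * κ)
    - (Real.sqrt n : ℂ) * besselJ p κ * besselJ' p ((Real.sqrt n : ℂ) * κ))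

open scoped Topology

/-- The series `∑ c m (z/2)^(2m+p)` is entire when `c` decays faster than any geometric sequence,
and the Euler operator `z d/dz` acts on it termwise. -/
theorem differentiable_and_hasSum_tsum_half_pow (p : ℕ) (c : ℕ → ℂ)
    (hc : ∀ r : ℝ, 0 ≤ r → Summable fun m => ‖c m‖ * r ^ m) :
    Differentiable ℂ (fun z : ℂ => ∑' m, c m * (z / 2) ^ (2 * m + p)) ∧
    ∀ z : ℂ, HasSum (fun m => ((2 * m + p : ℕ) * c m) * (z / 2) ^ (2 * m + p))
      (z * deriv (fun z : ℂ => ∑' m, c m * (z / 2) ^ (2 * m + p)) z) := by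
  have key : ∀ R : ℝ, ∃ u : ℕ → ℝ, Summable u ∧
      ∀ (m : ℕ) (w : ℂ), w ∈ Metric.ball (0 : ℂ) R → ‖c m * (w / 2) ^ (2 * m + p)‖ ≤ u m := by
    intro R
    refine ⟨fun m => (‖c m‖ * (R ^ 2) ^ m) * |R| ^ p,
      (hc (R ^ 2) (sq_nonneg R)).mul_right _, fun m w hw => ?_⟩
    have h1 : ‖w / 2‖ ≤ |R| := by
      have h2 : ‖w‖ < R := by simpa using hw
      have h3 : ‖w / 2‖ = ‖w‖ / 2 := by simp
      rw [h3]
      have := norm_nonneg w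
      exact le_trans (by linarith) (le_abs_self R)
    calc ‖c m * (w / 2) ^ (2 * m + p)‖ = ‖c m‖ * ‖w / 2‖ ^ (2 * m + p) := by
          rw [norm_mul, norm_pow]
      _ ≤ ‖c m‖ * |R| ^ (2 * m + p) := by gcongr
      _ = (‖c m‖ * (R ^ 2) ^ m) * |R| ^ p := by rw [pow_add, pow_mul, sq_abs]; ring
  have hd : ∀ (m : ℕ) (U : Set ℂ), DifferentiableOn ℂ (fun z : ℂ => c m * (z / 2) ^ (2 * m + p)) U :=
    fun m U => by fun_prop
  constructor
  · intro z
    obtain ⟨u, hu, hb⟩ := key (‖z‖ + 1)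
    exact (Complex.differentiableOn_tsum_of_summable_norm hu (fun m => hd m _) Metric.isOpen_ball hb
      ).differentiableAt (Metric.isOpen_ball.mem_nhds (by simp))
  · intro z
    obtain ⟨u, hu, hb⟩ := key (‖z‖ + 1)
    have h := (Complex.hasSum_deriv_of_summable_norm (z := z) hu (fun m => hd m _)
      Metric.isOpen_ball hb (by simp)).mul_left z
    refine h.congr_fun fun m => ?_
    have h1 : HasDerivAt (fun z : ℂ => c m * (z / 2) ^ (2 * m + p))
        (c m * (((2 * m + p : ℕ) : ℂ) * (z / 2) ^ (2 * m + p - 1) * (1 / 2))) z :=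
      (((hasDerivAt_id z).div_const 2).pow _).const_mul _
    rw [h1.deriv]
    rcases Nat.eq_zero_or_pos (2 * m + p) with h0 | h0
    · simp [h0]
    · obtain ⟨k, hk⟩ := Nat.exists_eq_succ_of_ne_zero h0.ne'
      rw [hk, Nat.succ_sub_one, pow_succ]
      ring

/-- Multiplying by a linear factor preserves superexponential decay. -/
theorem summable_linear_mul (p : ℕ) (c : ℕ → ℂ)
    (hc : ∀ r : ℝ, 0 ≤ r → Summable fun m => ‖c m‖ * r ^ m) (r : ℝ) (hr : 0 ≤ r) :
    Summable fun m => ‖((2 * m + p : ℕ) : ℂ) * c m‖ * r ^ m := by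
  refine Summable.of_nonneg_of_le (fun m => by positivity) (fun m => ?_)
    ((hc (2 * r) (by positivity)).mul_left (2 + p : ℝ))
  have h1 : ((2 * m + p : ℕ) : ℝ) ≤ (2 + p) * 2 ^ m := by
    have h2 : (m : ℝ) ≤ 2 ^ m := by exact_mod_cast Nat.lt_two_pow_self.le
    have h3 : (1 : ℝ) ≤ 2 ^ m := one_le_pow₀ (by norm_num)
    push_cast
    nlinarith [(Nat.cast_nonneg p : (0 : ℝ) ≤ p)]
  calc ‖((2 * m + p : ℕ) : ℂ) * c m‖ * r ^ m = ((2 * m + p : ℕ) : ℝ) * (‖c m‖ * r ^ m) := by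
        rw [norm_mul, Complex.norm_natCast]; ring
    _ ≤ ((2 + p) * 2 ^ m) * (‖c m‖ * r ^ m) := by gcongr
    _ = (2 + p) * (‖c m‖ * (2 * r) ^ m) := by rw [mul_pow]; ring

/-- The coefficients of the Bessel series. -/
noncomputable def besselCoeff (p m : ℕ) : ℂ :=
  (-1 : ℂ) ^ m / ((Nat.factorial m : ℂ) * (Nat.factorial (m + p) : ℂ))

theorem summable_besselCoeff (p : ℕ) (r : ℝ) (hr : 0 ≤ r) :
    Summable fun m => ‖besselCoeff p m‖ * r ^ m := by
  refine Summable.of_nonneg_of_le (fun m => by positivity) (fun m => ?_)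
    (Real.summable_pow_div_factorial r)
  have h1 : (1 : ℝ) ≤ (Nat.factorial (m + p) : ℝ) := by exact_mod_cast Nat.factorial_pos _
  have h2 : (0 : ℝ) < (Nat.factorial m : ℝ) := by exact_mod_cast Nat.factorial_pos _
  simp only [besselCoeff, norm_div, norm_pow, norm_neg, norm_one, one_pow, norm_mul,
    Complex.norm_natCast]
  rw [div_mul_eq_mul_div, one_mul]
  gcongr
  exact le_mul_of_one_le_right h2.le h1

/-- The image of `J_p` under the Euler operator `z d/dz`. -/
noncomputable def besselEuler (p : ℕ) (z : ℂ) : ℂ := z * deriv (besselJ p) z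

theorem differentiable_besselJ (p : ℕ) : Differentiable ℂ (besselJ p) :=
  (differentiable_and_hasSum_tsum_half_pow p _ (summable_besselCoeff p)).1

theorem besselEuler_eq_tsum (p : ℕ) : besselEuler p = fun z : ℂ =>
    ∑' m, (((2 * m + p : ℕ) : ℂ) * besselCoeff p m) * (z / 2) ^ (2 * m + p) :=
  funext fun z => ((differentiable_and_hasSum_tsum_half_pow p _ (summable_besselCoeff p)).2 z).tsum_eq.symm

theorem differentiable_besselEuler (p : ℕ) : Differentiable ℂ (besselEuler p) := by
  rw [besselEuler_eq_tsum]
  exact (differentiable_and_hasSum_tsum_half_pow p _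
    (summable_linear_mul p _ (summable_besselCoeff p))).1

theorem besselCoeff_succ (p m : ℕ) :
    4 * ((m + 1 : ℕ) : ℂ) * ((m + 1 + p : ℕ) : ℂ) * besselCoeff p (m + 1)
      = -4 * besselCoeff p m := by
  have h1 : ((m + 1 : ℕ) : ℂ) ≠ 0 := by exact_mod_cast Nat.succ_ne_zero m
  have h2 : ((m + p + 1 : ℕ) : ℂ) ≠ 0 := by exact_mod_cast Nat.succ_ne_zero (m + p)
  have h3 : (Nat.factorial m : ℂ) ≠ 0 := by exact_mod_cast Nat.factorial_ne_zero m
  have h4 : (Nat.factorial (m + p) : ℂ) ≠ 0 := by exact_mod_cast Nat.factorial_ne_zero _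
  have h5 : m + 1 + p = m + p + 1 := by omega
  rw [besselCoeff, besselCoeff, h5, Nat.factorial_succ, Nat.factorial_succ, Nat.cast_mul,
    Nat.cast_mul, pow_succ]
  field_simp

/-- Bessel's differential equation. -/
theorem mul_deriv_besselEuler (p : ℕ) (z : ℂ) :
    z * deriv (besselEuler p) z = ((p : ℂ) ^ 2 - z ^ 2) * besselJ p z := by
  have hs : HasSum (fun m => besselCoeff p m * (z / 2) ^ (2 * m + p)) (besselJ p z) := by
    refine Summable.hasSum (Summable.of_norm ?_)
    refine ((summable_besselCoeff p (‖z / 2‖ ^ 2) (by positivity)).mul_right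
      (‖z / 2‖ ^ p)).congr fun m => ?_
    rw [norm_mul, norm_pow, pow_add, pow_mul, mul_assoc]
  have h2 := (differentiable_and_hasSum_tsum_half_pow p _
    (summable_linear_mul p _ (summable_besselCoeff p))).2 z
  rw [← besselEuler_eq_tsum] at h2
  have h3 := h2.sub (hs.mul_left ((p : ℂ) ^ 2))
  have h4 : HasSum (fun m => ((2 * (m + 1) + p : ℕ) : ℂ) * (((2 * (m + 1) + p : ℕ) : ℂ) *
      besselCoeff p (m + 1)) * (z / 2) ^ (2 * (m + 1) + p) -
      (p : ℂ) ^ 2 * (besselCoeff p (m + 1) * (z / 2) ^ (2 * (m + 1) + p)))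
      (-z ^ 2 * besselJ p z) := by
    refine (hs.mul_left (-z ^ 2)).congr_fun fun m => ?_
    have h := besselCoeff_succ p m
    have e : (z / 2) ^ (2 * (m + 1) + p) = (z / 2) ^ (2 * m + p) * (z / 2) ^ 2 := by
      rw [← pow_add]; congr 1; omega
    rw [e]
    push_cast at h ⊢
    linear_combination (z / 2) ^ (2 * m + p) * (z / 2) ^ 2 * h
  have h5 := (hasSum_nat_add_iff' 1).2 h3
  have h6 := h5.unique h4
  simp only [Finset.sum_range_one, mul_zero, zero_add] at h6
  linear_combination h6

/-- Nonzero zeros of `J_p` are simple, unless `J_p` vanishes identically. -/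
theorem besselEuler_ne_zero (p : ℕ) {a b : ℂ} (ha : besselEuler p a ≠ 0) (hb : b ≠ 0)
    (hJ : besselJ p b = 0) : besselEuler p b ≠ 0 := by
  intro hQ
  have aJ : AnalyticAt ℂ (besselJ p) b := (differentiable_besselJ p).analyticAt b
  have aQ : AnalyticAt ℂ (besselEuler p) b := (differentiable_besselEuler p).analyticAt b
  have aid : AnalyticAt ℂ (fun z : ℂ => z) b := analyticAt_id
  have oid : analyticOrderAt (fun z : ℂ => z) b = 0 := aid.analyticOrderAt_eq_zero.2 hb
  have h1 := aJ.analyticOrderAt_deriv_add_one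
  have h2 := aQ.analyticOrderAt_deriv_add_one
  simp only [hJ, hQ, sub_zero] at h1 h2
  have h3 : analyticOrderAt (besselEuler p) b = analyticOrderAt (deriv (besselJ p)) b := by
    have : besselEuler p = (fun z : ℂ => z) * deriv (besselJ p) := rfl
    rw [this, analyticOrderAt_mul aid aJ.deriv, oid, zero_add]
  have h4 : analyticOrderAt (deriv (besselEuler p)) b
      = analyticOrderAt (fun z : ℂ => (p : ℂ) ^ 2 - z ^ 2) b + analyticOrderAt (besselJ p) b := by
    have : (fun z : ℂ => z) * deriv (besselEuler p)
        = (fun z : ℂ => (p : ℂ) ^ 2 - z ^ 2) * besselJ p :=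
      funext fun z => mul_deriv_besselEuler p z
    rw [← analyticOrderAt_mul (by fun_prop) aJ, ← this, analyticOrderAt_mul aid aQ.deriv, oid,
      zero_add]
  have htop : analyticOrderAt (besselJ p) b = ⊤ := by
    by_contra hne
    obtain ⟨k, hk⟩ := ENat.ne_top_iff_exists.1 hne
    have hle : analyticOrderAt (besselJ p) b + 1 + 1 ≤ analyticOrderAt (besselJ p) b := by
      calc _ ≤ analyticOrderAt (deriv (besselEuler p)) b + 1 + 1 := by
            gcongr; rw [h4]; exact le_add_self
        _ = analyticOrderAt (besselJ p) b := by rw [h2, h3]; exact h1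
    rw [← hk] at hle
    have : k + 1 + 1 ≤ k := by exact_mod_cast hle
    omega
  have hz : besselJ p = fun _ => 0 :=
    AnalyticOnNhd.eq_of_eventuallyEq (z₀ := b) (fun z _ => (differentiable_besselJ p).analyticAt z)
      (fun _ _ => analyticAt_const) (analyticOrderAt_eq_top.1 htop)
  apply ha
  simp [besselEuler, hz]

/-- A complex form of l'Hôpital's rule for vanishing order `k + 1`. -/
theorem tendsto_div_pow_succ_of_hasDerivAt {f R : ℂ → ℂ} {a : ℂ} (k : ℕ)
    (hf : ∀ᶠ z in 𝓝 a, HasDerivAt f ((z - a) ^ k * R z) z) (hR : ContinuousAt R a)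
    (hfa : f a = 0) :
    Tendsto (fun z => f z / (z - a) ^ (k + 1)) (𝓝[≠] a) (𝓝 (R a / (k + 1))) := by
  rw [Metric.tendsto_nhds]
  intro ε hε
  have hk : (k + 1 : ℂ) ≠ 0 := by exact_mod_cast Nat.succ_ne_zero k
  obtain ⟨δ, hδ, hball⟩ := Metric.eventually_nhds_iff_ball.1
    (hf.and (Metric.tendsto_nhds.1 hR (ε / 2) (half_pos hε)))
  have hmem : ∀ᶠ z in 𝓝[≠] a, z ∈ Metric.ball a δ ∧ z ≠ a :=
    Filter.inter_mem (mem_nhdsWithin_of_mem_nhds (Metric.ball_mem_nhds a hδ)) self_mem_nhdsWithin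
  filter_upwards [hmem] with z ⟨hz, hza⟩
  have hza' : z - a ≠ 0 := sub_ne_zero.2 hza
  have hsub : Metric.closedBall a ‖z - a‖ ⊆ Metric.ball a δ :=
    Metric.closedBall_subset_ball (by simpa [dist_eq_norm] using hz)
  have hmv := Convex.norm_image_sub_le_of_norm_hasDerivWithin_le
    (f := fun w => f w - R a / (k + 1) * (w - a) ^ (k + 1))
    (f' := fun w => (w - a) ^ k * (R w - R a)) (s := Metric.closedBall a ‖z - a‖)
    (C := ‖z - a‖ ^ k * (ε / 2)) (x := a) (y := z)
    (fun w hw => by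
      have h1 := (hball w (hsub hw)).1
      have h2 : HasDerivAt (fun w : ℂ => R a / (k + 1) * (w - a) ^ (k + 1))
          (R a / (k + 1) * (((k + 1 : ℕ) : ℂ) * (w - a) ^ (k + 1 - 1) * 1)) w :=
        (((hasDerivAt_id w).sub_const a).pow (k + 1)).const_mul _
      refine HasDerivAt.hasDerivWithinAt ?_
      refine (h1.fun_sub h2).congr_deriv ?_
      rw [Nat.add_sub_cancel]
      push_cast
      field_simp)
    (fun w hw => by
      rw [norm_mul, norm_pow]
      have h1 : ‖w - a‖ ≤ ‖z - a‖ := by simpa [dist_eq_norm] using hw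
      have h2 : ‖R w - R a‖ ≤ ε / 2 := by
        simpa [dist_eq_norm] using (hball w (hsub hw)).2.le
      gcongr)
    (convex_closedBall a _) (by simp) (by simp [dist_eq_norm])
  simp only [hfa, sub_self, ne_eq, Nat.succ_ne_zero, not_false_eq_true, zero_pow, mul_zero,
    sub_zero] at hmv
  rw [dist_eq_norm]
  have e : f z / (z - a) ^ (k + 1) - R a / (k + 1)
      = (f z - R a / (k + 1) * (z - a) ^ (k + 1)) / (z - a) ^ (k + 1) := by
    field_simp
  have hpos : 0 < ‖z - a‖ ^ (k + 1) := by positivity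
  rw [e, norm_div, norm_pow, div_lt_iff₀ hpos]
  calc _ ≤ ‖z - a‖ ^ k * (ε / 2) * ‖z - a‖ := hmv
    _ = ε / 2 * ‖z - a‖ ^ (k + 1) := by ring
    _ < ε * ‖z - a‖ ^ (k + 1) := by gcongr; linarith

/-- Two solutions of Riccati equations with different coefficients that vanish at `1` separate at
third order. -/
theorem tendsto_riccati_sub_div_cube {G H : ℂ → ℂ} {A B P : ℂ}
    (hG : ∀ᶠ z in 𝓝 1, HasDerivAt G ((1 + (A * z ^ 2 - P) * G z ^ 2) / z) z)
    (hH : ∀ᶠ z in 𝓝 1, HasDerivAt H ((1 + (B * z ^ 2 - P) * H z ^ 2) / z) z)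
    (hG1 : G 1 = 0) (hH1 : H 1 = 0) :
    Tendsto (fun z => (G z - H z) / (z - 1) ^ 3) (𝓝[≠] 1) (𝓝 ((A - B) / 3)) := by
  have slope : ∀ {K : ℂ → ℂ} {C : ℂ},
      (∀ᶠ z in 𝓝 1, HasDerivAt K ((1 + (C * z ^ 2 - P) * K z ^ 2) / z) z) → K 1 = 0 →
      ContinuousAt (dslope K 1) 1 ∧ dslope K 1 1 = 1 ∧ ∀ z, K z = (z - 1) * dslope K 1 z := by
    intro K C hK hK1
    have h1 := hK.self_of_nhds
    refine ⟨continuousAt_dslope_same.2 h1.differentiableAt, ?_, fun z => ?_⟩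
    · rw [dslope_same, h1.deriv, hK1]; simp
    · simpa [hK1] using (sub_smul_dslope K 1 z).symm
  obtain ⟨cG, oG, eG⟩ := slope hG hG1
  obtain ⟨cH, oH, eH⟩ := slope hH hH1
  have h := tendsto_div_pow_succ_of_hasDerivAt (f := fun z => G z - H z) (a := 1)
    (R := fun z => ((A * z ^ 2 - P) * dslope G 1 z ^ 2 - (B * z ^ 2 - P) * dslope H 1 z ^ 2) / z) 2
    (by
      filter_upwards [hG, hH] with z h1 h2
      refine (h1.fun_sub h2).congr_deriv ?_
      rw [eG z, eH z]
      ring)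
    (by
      refine ContinuousAt.div ?_ continuousAt_id one_ne_zero
      exact ((by fun_prop : ContinuousAt (fun z : ℂ => A * z ^ 2 - P) 1).mul (cG.pow 2)).sub
        ((by fun_prop : ContinuousAt (fun z : ℂ => B * z ^ 2 - P) 1).mul (cH.pow 2)))
    (by simp [hG1, hH1])
  convert h using 2
  rw [oG, oH]
  norm_num

/-- The rescaled quotient `J_p(cz) / (cz J_p'(cz))`. -/
noncomputable def besselRatio (p : ℕ) (c z : ℂ) : ℂ := besselJ p (c * z) / besselEuler p (c * z)

theorem analyticAt_besselRatio (p : ℕ) {c : ℂ} (hQ : besselEuler p c ≠ 0) :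
    AnalyticAt ℂ (besselRatio p c) 1 := by
  have hm : AnalyticAt ℂ (fun z : ℂ => c * z) 1 := by fun_prop
  exact (((differentiable_besselJ p).analyticAt _).comp hm).div
    (((differentiable_besselEuler p).analyticAt _).comp hm) (by simpa using hQ)

theorem eventually_besselEuler_ne_zero (p : ℕ) {c : ℂ} (hQ : besselEuler p c ≠ 0) :
    ∀ᶠ z in 𝓝 (1 : ℂ), besselEuler p (c * z) ≠ 0 := by
  have hc : ContinuousAt (fun z : ℂ => besselEuler p (c * z)) 1 :=
    ((differentiable_besselEuler p).continuous.comp (continuous_const.mul continuous_id)).continuousAt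
  exact hc.eventually_ne (by simpa using hQ)

theorem hasDerivAt_besselRatio (p : ℕ) {c z : ℂ} (hz : z ≠ 0) (hQ : besselEuler p (c * z) ≠ 0) :
    HasDerivAt (besselRatio p c)
      ((1 + (c ^ 2 * z ^ 2 - (p : ℂ) ^ 2) * besselRatio p c z ^ 2) / z) z := by
  have hm : HasDerivAt (fun z : ℂ => c * z) c z := by
    simpa using (hasDerivAt_id z).const_mul c
  have h1 := (differentiable_besselJ p (c * z)).hasDerivAt.comp z hm
  have h2 := (differentiable_besselEuler p (c * z)).hasDerivAt.comp z hm
  have e1 : c * z * deriv (besselJ p) (c * z) = besselEuler p (c * z) := rfl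
  have e2 := mul_deriv_besselEuler p (c * z)
  refine (h1.div h2 hQ).congr_deriv ?_
  simp only [besselRatio, Function.comp]
  field_simp
  linear_combination besselEuler p (c * z) * e1 - besselJ p (c * z) * e2

theorem eventually_hasDerivAt_besselRatio (p : ℕ) {c : ℂ} (hQ : besselEuler p c ≠ 0) :
    ∀ᶠ z in 𝓝 (1 : ℂ), HasDerivAt (besselRatio p c)
      ((1 + (c ^ 2 * z ^ 2 - (p : ℂ) ^ 2) * besselRatio p c z ^ 2) / z) z := by
  filter_upwards [eventually_besselEuler_ne_zero p hQ, eventually_ne_nhds one_ne_zero] with z h1 h2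
  exact hasDerivAt_besselRatio p h2 h1

theorem hasStrictDerivAt_besselRatio (p : ℕ) {c : ℂ} (hQ : besselEuler p c ≠ 0)
    (hJ : besselJ p c = 0) : HasStrictDerivAt (besselRatio p c) 1 1 := by
  have h := (analyticAt_besselRatio p hQ).hasStrictDerivAt
  rw [(eventually_hasDerivAt_besselRatio p hQ).self_of_nhds.deriv] at h
  simpa [besselRatio, hJ] using h

theorem Fp_eq (p : ℕ) (κ : ℂ) (n : ℝ) : Fp p κ n =
    besselEuler p κ * besselJ p ((Real.sqrt n : ℂ) * κ)
      - besselJ p κ * besselEuler p ((Real.sqrt n : ℂ) * κ) := by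
  simp only [Fp, besselEuler, besselJ']
  ring

theorem tendsto_sqrt_div_sub_one {s : ℝ} (hs : 0 < s) :
    Tendsto (fun n : ℝ => ((√n / √s - 1 : ℝ) : ℂ) / ((n : ℂ) - (s : ℂ))) (𝓝[≠] s)
      (𝓝 (1 / (2 * s) : ℂ)) := by
  have hd := hasDerivAt_iff_tendsto_slope.1 ((Real.hasDerivAt_sqrt hs.ne').div_const (√s))
  have h := (Complex.continuous_ofReal.tendsto _).comp hd
  have hq : √s ≠ 0 := (Real.sqrt_pos.2 hs).ne'
  have hval : (1 / (2 * √s) / √s : ℝ) = 1 / (2 * s) := by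
    rw [div_div, mul_assoc, Real.mul_self_sqrt hs.le]
  rw [hval] at h
  push_cast at h
  refine h.congr fun n => ?_
  simp only [Function.comp, slope_def_field, div_self hq]
  push_cast
  rfl

/-- the limit of the cubed displacement difference quotient. -/
theorem stmt_9 (p : ℕ) (nst : ℝ) (hnst : 0 < nst) (hnst1 : nst ≠ 1) (ε : ℝ) (hε : 0 < ε)
    (κ : ℝ → ℂ) (hcont : ContinuousOn κ (Set.Ioo (nst - ε) (nst + ε)))
    (hF : ∀ n ∈ Set.Ioo (nst - ε) (nst + ε), Fp p (κ n) n = 0)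
    (hdiff : ∀ n ∈ Set.Ioo (nst - ε) (nst + ε), n ≠ nst → DifferentiableAt ℝ κ n)
    (κs : ℝ) (hκs : 0 < κs) (hval : κ nst = (κs : ℂ))
    (hJ : besselJ p (κs : ℂ) = 0) (hJ' : besselJ' p (κs : ℂ) ≠ 0)
    (hJne : ∀ n ∈ Set.Ioo (nst - ε) (nst + ε), n ≠ nst →
      besselJ p (κ n) ≠ 0 ∧ besselJ p ((Real.sqrt n : ℂ) * κ n) ≠ 0) :
    Filter.Tendsto (fun n => (κ n - (κs : ℂ)) ^ 3 / ((n : ℂ) - (nst : ℂ)))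
      (nhdsWithin nst (Set.Ioo (nst - ε) (nst + ε) \ {nst}))
      (nhds ((-(3 * κs) / (2 * nst * (nst - 1)) : ℝ) : ℂ)) := by
  have hs : √nst ≠ 0 := (Real.sqrt_pos.2 hnst).ne'
  have hsC : (√nst : ℂ) ≠ 0 := Complex.ofReal_ne_zero.2 hs
  have hsq : (√nst : ℂ) ^ 2 = nst := by exact_mod_cast Real.sq_sqrt hnst.le
  have hκC : (κs : ℂ) ≠ 0 := Complex.ofReal_ne_zero.2 hκs.ne'
  have hnC : (nst : ℂ) ≠ 0 := Complex.ofReal_ne_zero.2 hnst.ne'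
  have hn1 : (nst : ℂ) - 1 ≠ 0 := sub_ne_zero.2 (by exact_mod_cast hnst1)
  have hmem : nst ∈ Set.Ioo (nst - ε) (nst + ε) := ⟨by linarith, by linarith⟩
  set a : ℂ := (κs : ℂ) with ha
  set b : ℂ := (√nst : ℂ) * (κs : ℂ) with hb
  have hbne : b ≠ 0 := mul_ne_zero hsC hκC
  have hQa : besselEuler p a ≠ 0 := mul_ne_zero hκC hJ'
  have hJb : besselJ p b = 0 := by
    have h := hF nst hmem
    rw [Fp_eq, hval, hJ, zero_mul, sub_zero] at h
    exact (mul_eq_zero.1 h).resolve_left hQa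
  have hQb : besselEuler p b ≠ 0 := besselEuler_ne_zero p hQa hbne hJb
  set L := nhdsWithin nst (Set.Ioo (nst - ε) (nst + ε) \ {nst}) with hL
  have hLmem : ∀ᶠ n in L, n ∈ Set.Ioo (nst - ε) (nst + ε) ∧ n ≠ nst := self_mem_nhdsWithin
  have hLne : L ≤ 𝓝[≠] nst := nhdsWithin_mono _ fun n hn => hn.2
  have hκL : Tendsto κ L (𝓝 a) := by
    have h : Tendsto κ (nhdsWithin nst (Set.Ioo (nst - ε) (nst + ε))) (𝓝 (κ nst)) := hcont nst hmem
    rw [hval] at h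
    exact h.mono_left (nhdsWithin_mono _ Set.sdiff_subset)
  let x : ℝ → ℂ := fun n => κ n / a
  let y : ℝ → ℂ := fun n => ((√n / √nst : ℝ) : ℂ) * x n
  have hx : Tendsto x L (𝓝 1) := by
    simpa [div_self hκC] using hκL.div_const a
  have hxne : ∀ᶠ n in L, x n ≠ 1 := by
    filter_upwards [hLmem] with n ⟨hn, hne⟩ h
    have : κ n = a := (div_eq_one_iff_eq hκC).1 h
    exact (hJne n hn hne).1 (this ▸ hJ)
  have hx' : Tendsto x L (𝓝[≠] 1) := tendsto_nhdsWithin_iff.2 ⟨hx, hxne⟩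
  have hq : Tendsto (fun n : ℝ => ((√n / √nst : ℝ) : ℂ)) L (𝓝 1) := by
    have h : Tendsto (fun n : ℝ => ((√n / √nst : ℝ) : ℂ)) (𝓝 nst)
        (𝓝 ((√nst / √nst : ℝ) : ℂ)) :=
      (Complex.continuous_ofReal.comp (Real.continuous_sqrt.div_const _)).tendsto nst
    rw [div_self hs, Complex.ofReal_one] at h
    exact h.mono_left nhdsWithin_le_nhds
  have hy : Tendsto y L (𝓝 1) := by simpa only [mul_one] using hq.mul hx
  have hax : ∀ n, a * x n = κ n := fun n => mul_div_cancel₀ _ hκC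
  have hby : ∀ n, b * y n = (√n : ℂ) * κ n := fun n => by
    rw [← hax n]
    simp only [y, hb, Complex.ofReal_div, ← ha]
    field_simp
  have heq : ∀ᶠ n in L, besselRatio p a (x n) = besselRatio p b (y n) := by
    filter_upwards [hLmem, hx.eventually (eventually_besselEuler_ne_zero p hQa),
      hy.eventually (eventually_besselEuler_ne_zero p hQb)] with n hn h1 h2
    have h := hF n hn.1
    rw [Fp_eq, ← hby, ← hax] at h
    rw [besselRatio, besselRatio, div_eq_div_iff h1 h2]
    linear_combination -h
  have hD := (tendsto_riccati_sub_div_cube (eventually_hasDerivAt_besselRatio p hQa)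
    (eventually_hasDerivAt_besselRatio p hQb) (by simp [besselRatio, hJ])
    (by simp [besselRatio, hJb])).comp hx'
  have hyx : ∀ᶠ n in L, y n - x n ≠ 0 ∧ ((√n / √nst - 1 : ℝ) : ℂ) ≠ 0 ∧ x n ≠ 0 ∧
      (n : ℂ) - nst ≠ 0 := by
    filter_upwards [hLmem, hx.eventually_ne one_ne_zero, mem_nhdsWithin_of_mem_nhds
      (lt_mem_nhds hnst)] with n hn h0 hpos
    have h1 : √n / √nst - 1 ≠ 0 := by
      rw [sub_ne_zero, ne_eq, div_eq_one_iff_eq hs, Real.sqrt_inj (le_of_lt hpos) hnst.le]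
      exact hn.2
    have h2 : ((√n / √nst - 1 : ℝ) : ℂ) ≠ 0 := Complex.ofReal_ne_zero.2 h1
    refine ⟨?_, h2, h0, sub_ne_zero.2 (by exact_mod_cast hn.2)⟩
    have : y n - x n = ((√n / √nst - 1 : ℝ) : ℂ) * x n := by
      simp only [y]; push_cast; ring
    rw [this]
    exact mul_ne_zero h2 h0
  have hS : Tendsto (fun n => (besselRatio p b (y n) - besselRatio p b (x n)) / (y n - x n)) L
      (𝓝 1) := by
    have h := (hasStrictDerivAt_besselRatio p hQb hJb).isLittleO.comp_tendsto (hy.prodMk_nhds hx)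
    have h' := h.tendsto_div_nhds_zero.add_const 1
    rw [zero_add] at h'
    refine h'.congr' ?_
    filter_upwards [hyx] with n hn
    have := hn.1
    simp only [Function.comp]
    simp
    field_simp
    ring
  have hAB : (a ^ 2 - b ^ 2) / 3 ≠ 0 := by
    have : a ^ 2 - b ^ 2 = -(a ^ 2 * (nst - 1)) := by rw [hb, mul_pow, hsq]; ring
    rw [this]
    exact div_ne_zero (neg_ne_zero.2 (mul_ne_zero (pow_ne_zero 2 hκC) hn1)) (by norm_num)
  have hlim := (((hS.div hD hAB).mul hx).mul
    ((tendsto_sqrt_div_sub_one hnst).mono_left hLne)).const_mul (a ^ 3)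
  have hval' : a ^ 3 * (1 / ((a ^ 2 - b ^ 2) / 3) * 1 * (1 / (2 * nst)))
      = ((-(3 * κs) / (2 * nst * (nst - 1)) : ℝ) : ℂ) := by
    have : a ^ 2 - b ^ 2 = -(a ^ 2 * (nst - 1)) := by rw [hb, mul_pow, hsq]; ring
    rw [this]
    push_cast
    rw [← ha]
    field_simp
  rw [hval'] at hlim
  refine hlim.congr' ?_
  filter_upwards [hyx, heq, hxne, hS.eventually_ne one_ne_zero] with n ⟨h1, h2, h3, h4⟩ he hx1 hS0
  have hD0 : besselRatio p b (y n) - besselRatio p b (x n) ≠ 0 :=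
    (div_ne_zero_iff.1 hS0).1
  have hx1' : x n - 1 ≠ 0 := sub_ne_zero.2 hx1
  have ey : y n - x n = ((√n / √nst - 1 : ℝ) : ℂ) * x n := by
    simp only [y]; push_cast; ring
  have eκ : κ n - a = a * (x n - 1) := by rw [mul_sub, hax, mul_one]
  simp only [Function.comp, Pi.div_apply]
  rw [he, eκ, ey]
  generalize ((√n / √nst - 1 : ℝ) : ℂ) = q at *
  field_simp
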